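/- arXiv:1805.02163 — 10 statements merged into one kernel-verified Lean document; each statement's English description precedes it below -/
import Mathlib

section
/- Let N ≥ 0 be an integer. (a) If s is a real number with 2N ≤ s ≤ 2N+1, then C(s, 2k+1) ≥ 0 for every natural number k. (b) If s is a real number with 2N+1 < s < 2N+2, then C(s, 2k+1) ≥ 0 for every natural number k with k ≤ N, and C(s, 2k+1) ≤ 0 for every natural number k with k ≥ N+1. -/
/-- The generalized binomial coefficient `C(s, j) = s(s-1)⋯(s-j+1)/j!`. -/
noncomputable def genBinom (s : ℝ) (j : ℕ) : ℝ :=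
  (descPochhammer ℝ j).eval s / (Nat.factorial j)

theorem genBinom_succ (s : ℝ) (j : ℕ) :
    genBinom s (j + 1) = genBinom s j * ((s - j) / (j + 1)) := by
  simp only [genBinom, descPochhammer_succ_eval, Nat.factorial_succ]
  push_cast
  field_simp

theorem genBinom_nonneg {s : ℝ} {j : ℕ} (h : (j : ℝ) ≤ s + 1) : 0 ≤ genBinom s j :=
  div_nonneg (descPochhammer_nonneg (by linarith)) (Nat.cast_nonneg _)

/-- Past `s`, the generalized binomial coefficients alternate in sign, so stepping the lower index
by two multiplies by a nonnegative factor. -/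
theorem exists_genBinom_add_two_eq_mul {s : ℝ} {j : ℕ} (h : s ≤ j) :
    ∃ c : ℝ, 0 ≤ c ∧ genBinom s (j + 2) = genBinom s j * c := by
  refine ⟨(s - j) / (j + 1) * ((s - (j + 1)) / (j + 1 + 1)), ?_, ?_⟩
  · exact mul_nonneg_of_nonpos_of_nonpos
      (div_nonpos_of_nonpos_of_nonneg (by linarith) (by positivity))
      (div_nonpos_of_nonpos_of_nonneg (by linarith) (by positivity))
  · rw [genBinom_succ s (j + 1), genBinom_succ s j]
    push_cast
    ring

/-- Sign properties of the odd-index generalized binomial coefficients: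
(a) if `2N ≤ s ≤ 2N+1` then `C(s, 2k+1) ≥ 0` for all `k`;
(b) if `2N+1 < s < 2N+2` then `C(s, 2k+1) ≥ 0` for `k ≤ N` and `C(s, 2k+1) ≤ 0`
for `k ≥ N+1`. -/
theorem genBinom_odd_sign (N : ℕ) :
    (∀ s : ℝ, 2 * (N : ℝ) ≤ s → s ≤ 2 * (N : ℝ) + 1 →
      ∀ k : ℕ, 0 ≤ genBinom s (2 * k + 1)) ∧
    (∀ s : ℝ, 2 * (N : ℝ) + 1 < s → s < 2 * (N : ℝ) + 2 →
      (∀ k : ℕ, k ≤ N → 0 ≤ genBinom s (2 * k + 1)) ∧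
      (∀ k : ℕ, N + 1 ≤ k → genBinom s (2 * k + 1) ≤ 0)) := by
  refine ⟨fun s hs hs' k => ?_, fun s hs hs' => ⟨fun k hk => ?_, fun k hk => ?_⟩⟩
  · rcases le_total k N with hk | hk
    · have : (k : ℝ) ≤ N := mod_cast hk
      exact genBinom_nonneg (by push_cast; linarith)
    · induction k, hk using Nat.le_induction with
      | base => exact genBinom_nonneg (by push_cast; linarith)
      | succ k hk ih =>
        have : (N : ℝ) ≤ k := mod_cast hk
        obtain ⟨c, hc, h⟩ := exists_genBinom_add_two_eq_mul (s := s) (j := 2 * k + 1)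
          (by push_cast; linarith)
        exact (mul_nonneg ih hc).trans_eq h.symm
  · have : (k : ℝ) ≤ N := mod_cast hk
    exact genBinom_nonneg (by push_cast; linarith)
  · induction k, hk using Nat.le_induction with
    | base =>
      rw [genBinom_succ]
      exact mul_nonpos_of_nonneg_of_nonpos (genBinom_nonneg (by push_cast; linarith))
        (div_nonpos_of_nonpos_of_nonneg (by push_cast; linarith) (by positivity))
    | succ k hk ih =>
      have : (N : ℝ) + 1 ≤ k := mod_cast hk
      obtain ⟨c, hc, h⟩ := exists_genBinom_add_two_eq_mul (s := s) (j := 2 * k + 1)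
        (by push_cast; linarith)
      exact h.trans_le (mul_nonpos_of_nonpos_of_nonneg ih hc)
end

section
/- For every real number s ≥ 0 and every real number t with 0 ≤ t ≤ 1, one has (1+t)^s − (1−t)^s ≥ min(2s, 2^s)·t. -/
lemma two_le_rpow_one_add_add_rpow_one_sub {p t : ℝ} (hp : p ≤ 0 ∨ 1 ≤ p)
    (ht0 : 0 ≤ t) (ht1 : t < 1) : 2 ≤ (1 + t) ^ p + (1 - t) ^ p := by
  rcases hp with hp | hp
  · have h : 1 ≤ (1 + t) ^ p * (1 - t) ^ p := by
      rw [← Real.mul_rpow (by linarith) (by linarith)]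
      exact Real.one_le_rpow_of_pos_of_le_one_of_nonpos (by nlinarith) (by nlinarith) hp
    have h1 : 0 < (1 + t) ^ p := Real.rpow_pos_of_pos (by linarith) p
    have h2 : 0 < (1 - t) ^ p := Real.rpow_pos_of_pos (by linarith) p
    nlinarith [sq_nonneg ((1 + t) ^ p - (1 - t) ^ p)]
  · have h1 := one_add_mul_self_le_rpow_one_add (s := t) (by linarith) hp
    have h2 := one_add_mul_self_le_rpow_one_add (s := -t) (by linarith) hp
    rw [← sub_eq_add_neg] at h2
    linarith

lemma hasDerivAt_one_add_rpow (p : ℝ) {t : ℝ} (ht : -1 < t) :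
    HasDerivAt (fun x : ℝ => (1 + x) ^ p) (p * (1 + t) ^ (p - 1)) t := by
  have h := ((hasDerivAt_id t).const_add 1).rpow_const (p := p)
    (Or.inl (by simp only [id]; linarith))
  simpa using h

lemma hasDerivAt_one_sub_rpow (p : ℝ) {t : ℝ} (ht : t < 1) :
    HasDerivAt (fun x : ℝ => (1 - x) ^ p) (-(p * (1 - t) ^ (p - 1))) t := by
  have h := ((hasDerivAt_id t).const_sub 1).rpow_const (p := p)
    (Or.inl (by simp only [id]; linarith))
  simpa using h

lemma continuous_rpow_one_add_sub_rpow_one_sub {s : ℝ} (hs : 0 ≤ s) :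
    Continuous fun x : ℝ => (1 + x) ^ s - (1 - x) ^ s :=
  ((continuous_const.add continuous_id).rpow_const fun _ => Or.inr hs).sub
    ((continuous_const.sub continuous_id).rpow_const fun _ => Or.inr hs)

lemma two_mul_mul_le_rpow_one_add_sub_rpow_one_sub {s t : ℝ} (hs : 0 ≤ s)
    (h : s ≤ 1 ∨ 2 ≤ s) (ht0 : 0 ≤ t) (ht1 : t ≤ 1) :
    2 * s * t ≤ (1 + t) ^ s - (1 - t) ^ s := by
  have hmono : MonotoneOn (fun x : ℝ => (1 + x) ^ s - (1 - x) ^ s - 2 * s * x)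
      (Set.Icc 0 1) := by
    refine monotoneOn_of_hasDerivWithinAt_nonneg (convex_Icc 0 1)
      ((continuous_rpow_one_add_sub_rpow_one_sub hs).sub
        (continuous_const.mul continuous_id)).continuousOn
      (f' := fun x => s * (1 + x) ^ (s - 1) - -(s * (1 - x) ^ (s - 1)) - 2 * s * 1) ?_ ?_
    · intro x hx
      rw [interior_Icc] at hx
      exact (((hasDerivAt_one_add_rpow s (by linarith [hx.1])).sub
        (hasDerivAt_one_sub_rpow s hx.2)).sub
          ((hasDerivAt_id x).const_mul (2 * s))).hasDerivWithinAt
    · intro x hx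
      rw [interior_Icc] at hx
      have := two_le_rpow_one_add_add_rpow_one_sub (p := s - 1)
        (h.imp (by intro; linarith) (by intro; linarith)) hx.1.le hx.2
      nlinarith
  have := hmono (Set.left_mem_Icc.2 zero_le_one) ⟨ht0, ht1⟩ ht0
  norm_num at this
  linarith

lemma concaveOn_rpow_one_add_sub_rpow_one_sub {s : ℝ} (h1 : 1 ≤ s) (h2 : s ≤ 2) :
    ConcaveOn ℝ (Set.Icc 0 1) fun x : ℝ => (1 + x) ^ s - (1 - x) ^ s := by
  refine concaveOn_of_hasDerivWithinAt2_nonpos (convex_Icc 0 1)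
    (continuous_rpow_one_add_sub_rpow_one_sub (by linarith)).continuousOn
    (f' := fun x => s * (1 + x) ^ (s - 1) - -(s * (1 - x) ^ (s - 1)))
    (f'' := fun x => s * ((s - 1) * (1 + x) ^ (s - 1 - 1)) -
      -(s * -((s - 1) * (1 - x) ^ (s - 1 - 1)))) ?_ ?_ ?_ <;>
    intro x hx <;> rw [interior_Icc] at hx
  · exact ((hasDerivAt_one_add_rpow s (by linarith [hx.1])).sub
      (hasDerivAt_one_sub_rpow s hx.2)).hasDerivWithinAt
  · exact (((hasDerivAt_one_add_rpow (s - 1) (by linarith [hx.1])).const_mul s).sub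
      ((hasDerivAt_one_sub_rpow (s - 1) hx.2).const_mul s).neg).hasDerivWithinAt
  · have h := Real.rpow_le_rpow_of_nonpos (x := 1 - x) (y := 1 + x) (z := s - 1 - 1)
      (by linarith [hx.2]) (by linarith [hx.1]) (by linarith)
    have hs : 0 ≤ s * (s - 1) := mul_nonneg (by linarith) (by linarith)
    nlinarith [mul_le_mul_of_nonneg_left h hs]

lemma two_rpow_mul_le_rpow_one_add_sub_rpow_one_sub {s t : ℝ} (h1 : 1 ≤ s) (h2 : s ≤ 2)
    (ht0 : 0 ≤ t) (ht1 : t ≤ 1) : 2 ^ s * t ≤ (1 + t) ^ s - (1 - t) ^ s := by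
  have h := (concaveOn_rpow_one_add_sub_rpow_one_sub h1 h2).2
    (Set.left_mem_Icc.2 zero_le_one) (Set.right_mem_Icc.2 zero_le_one)
    (sub_nonneg.2 ht1) ht0 (sub_add_cancel 1 t)
  have hs : s ≠ 0 := by linarith
  norm_num [Real.zero_rpow hs] at h
  linarith

/-- For every real `s ≥ 0` and `0 ≤ t ≤ 1`, one has
`(1+t)^s − (1−t)^s ≥ min(2s, 2^s) t` (powers are rpow, with `0^0 = 1`). -/
theorem rpow_diff_ge_min_mul (s : ℝ) (hs : 0 ≤ s) (t : ℝ) (ht0 : 0 ≤ t) (ht1 : t ≤ 1) :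
    (1 + t) ^ s - (1 - t) ^ s ≥ min (2 * s) ((2 : ℝ) ^ s) * t := by
  by_cases h : s ≤ 1 ∨ 2 ≤ s
  · exact (mul_le_mul_of_nonneg_right (min_le_left _ _) ht0).trans
      (two_mul_mul_le_rpow_one_add_sub_rpow_one_sub hs h ht0 ht1)
  · push Not at h
    exact (mul_le_mul_of_nonneg_right (min_le_right _ _) ht0).trans
      (two_rpow_mul_le_rpow_one_add_sub_rpow_one_sub h.1.le h.2.le ht0 ht1)
end

section
/- For every real number s ≥ 0 and every real number x ≥ 1, one has (x+1)^s − (x−1)^s ≥ s·x^{s−1}. -/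
/-- First part of the elementary lower bound lemma: for every real `s ≥ 0` and
`x ≥ 1`, one has `(x+1)^s − (x−1)^s ≥ s x^{s−1}` (powers are rpow, `0^0 = 1`). -/
theorem rpow_succ_sub_pred_ge (s : ℝ) (hs : 0 ≤ s) (x : ℝ) (hx : 1 ≤ x) :
    (x + 1) ^ s - (x - 1) ^ s ≥ s * x ^ (s - 1) := by
  have hx0 : 0 < x := by linarith
  have hinv : x⁻¹ ≤ 1 := inv_le_one_of_one_le₀ hx
  have hinv0 : 0 < x⁻¹ := inv_pos.mpr hx0
  have hpow : 0 ≤ x ^ s := Real.rpow_nonneg hx0.le s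
  have hderiv : s * x ^ (s - 1) = x ^ s * (s * x⁻¹) := by
    rw [Real.rpow_sub_one hx0.ne']
    ring
  rcases le_total 1 s with h1 | h1
  · have hadd : (x + 1) ^ s = x ^ s * (1 + x⁻¹) ^ s := by
      rw [← Real.mul_rpow hx0.le (by linarith)]
      congr 1
      field_simp
    have hsub : (x - 1) ^ s ≤ x ^ s := Real.rpow_le_rpow (by linarith) (by linarith) hs
    have hbern := mul_le_mul_of_nonneg_left
      (one_add_mul_self_le_rpow_one_add (by linarith : -1 ≤ x⁻¹) h1) hpow
    rw [hadd, hderiv]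
    linarith
  · have hsub : (x - 1) ^ s = x ^ s * (1 + -x⁻¹) ^ s := by
      rw [← Real.mul_rpow hx0.le (by linarith)]
      congr 1
      field_simp
      ring
    have hadd : x ^ s ≤ (x + 1) ^ s := Real.rpow_le_rpow hx0.le (by linarith) hs
    have hbern := mul_le_mul_of_nonneg_left
      (rpow_one_add_le_one_add_mul_self (by linarith : -1 ≤ -x⁻¹) hs h1) hpow
    rw [hsub, hderiv]
    linarith
end

section
/- Let s be a real number with −1 < s < 0, and let l₀, l be real numbers with 2 ≤ l₀ ≤ l. Then (l+1)^s − (l−1)^s ≥ f_s(1/l₀)·l^{s−1}, where f_s(t) = ((1+t)^s − (1−t)^s)/t. Equivalently, setting η_s(l₀) = −f_s(1/l₀) > 0, one has (l+1)^s − (l−1)^s ≥ −η_s(l₀)·l^{s−1}. -/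
theorem convexOn_one_sub_rpow_sub_one_add_rpow {s : ℝ} (hs : s ≤ 0) :
    ConvexOn ℝ (Set.Ico 0 1) (fun t : ℝ => (1 - t) ^ s - (1 + t) ^ s) := by
  have hsub (p t : ℝ) (ht : t < 1) :
      HasDerivAt (fun x : ℝ => (1 - x) ^ p) (-(p * (1 - t) ^ (p - 1))) t := by
    have h := ((hasDerivAt_id' t).const_sub 1).rpow_const (p := p)
      (Or.inl (sub_pos.2 ht).ne')
    convert h using 1
    ring
  have hadd (p t : ℝ) (ht : 0 ≤ t) :
      HasDerivAt (fun x : ℝ => (1 + x) ^ p) (p * (1 + t) ^ (p - 1)) t := by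
    have h := ((hasDerivAt_id' t).const_add 1).rpow_const (p := p)
      (Or.inl (by positivity))
    convert h using 1
    ring
  refine convexOn_of_hasDerivWithinAt2_nonneg
    (f' := fun t => -(s * (1 - t) ^ (s - 1)) - s * (1 + t) ^ (s - 1))
    (f'' := fun t => -(s * -((s - 1) * (1 - t) ^ (s - 1 - 1)))
      - s * ((s - 1) * (1 + t) ^ (s - 1 - 1)))
    (convex_Ico 0 1) ?_ ?_ ?_ ?_
  · exact fun t ht => ((hsub s t ht.2).sub (hadd s t ht.1)).continuousAt.continuousWithinAt
  all_goals
    rw [interior_Ico]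
    rintro t ⟨ht0, ht1⟩
  · exact ((hsub s t ht1).sub (hadd s t ht0.le)).hasDerivWithinAt
  · exact (((hsub (s - 1) t ht1).const_mul s).neg.sub
      ((hadd (s - 1) t ht0.le).const_mul s)).hasDerivWithinAt
  · have h : (1 + t) ^ (s - 1 - 1) ≤ (1 - t) ^ (s - 1 - 1) :=
      Real.rpow_le_rpow_of_nonpos (by linarith) (by linarith) (by linarith)
    have := mul_nonneg (mul_nonneg_of_nonpos_of_nonpos hs (by linarith : s - 1 ≤ 0))
      (sub_nonneg.2 h)
    linarith

/-- Second part of the elementary lower bound lemma (negative exponents):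
for `−1 < s < 0` and real numbers `2 ≤ l₀ ≤ l`, one has
`(l+1)^s − (l−1)^s ≥ f_s(1/l₀) l^{s−1}` where `f_s(t) = ((1+t)^s − (1−t)^s)/t`;
moreover `η_s(l₀) = −f_s(1/l₀)` is positive. -/
theorem rpow_succ_sub_pred_ge_neg_exponent (s : ℝ) (hs1 : -1 < s) (hs0 : s < 0)
    (l₀ l : ℝ) (hl₀ : 2 ≤ l₀) (hl : l₀ ≤ l) :
    (l + 1) ^ s - (l - 1) ^ s
      ≥ (((1 + 1 / l₀) ^ s - (1 - 1 / l₀) ^ s) / (1 / l₀)) * l ^ (s - 1) ∧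
    0 < -(((1 + 1 / l₀) ^ s - (1 - 1 / l₀) ^ s) / (1 / l₀)) := by
  have hl₀_pos : 0 < l₀ := by linarith
  have hl_pos : 0 < l := by linarith
  have ht₀ : 0 < 1 / l₀ := by positivity
  have ht₀_lt : 1 / l₀ < 1 := by rw [div_lt_one hl₀_pos]; linarith
  have ht_lt : 1 / l < 1 := by rw [div_lt_one hl_pos]; linarith
  constructor
  · have hconv := (convexOn_one_sub_rpow_sub_one_add_rpow hs0.le).2
      (Set.left_mem_Ico.2 one_pos) (Set.mem_Ico.2 ⟨ht₀.le, ht₀_lt⟩)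
      (sub_nonneg.2 ((div_le_one hl_pos).2 hl)) (by positivity : 0 ≤ l₀ / l) (by ring)
    have harg : l₀ / l * (1 / l₀) = 1 / l := by field_simp
    simp only [smul_eq_mul, mul_zero, zero_add, harg, sub_zero, add_zero, sub_self] at hconv
    have hadd : (l + 1) ^ s = l ^ s * (1 + 1 / l) ^ s := by
      rw [← Real.mul_rpow hl_pos.le (by positivity)]
      congr 1
      field_simp
    have hsub : (l - 1) ^ s = l ^ s * (1 - 1 / l) ^ s := by
      rw [← Real.mul_rpow hl_pos.le (by linarith)]
      congr 1
      field_simp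
    rw [hadd, hsub, Real.rpow_sub_one hl_pos.ne']
    have := mul_le_mul_of_nonneg_left hconv (Real.rpow_nonneg hl_pos.le s)
    calc _ = -(l ^ s * (l₀ / l * ((1 - 1 / l₀) ^ s - (1 + 1 / l₀) ^ s))) := by
          rw [div_div_eq_mul_div, div_one]
          ring
      _ ≤ _ := by linarith
  · rw [← neg_div, neg_sub]
    exact div_pos (sub_pos.2 (Real.rpow_lt_rpow_of_neg (by linarith) (by linarith) hs0)) ht₀
end

section
/- Let d ≥ 2 and l ≥ 2 be integers, set α_l = (2l+d−2)(1 + 1/(l+d−2)) and β_l = (2l+d−2)(1 − 1/l), and let s be a real number such that either s ≥ 0, or d = 2 and s > −1/2. Then α_l·(l+1)^{2s} − β_l·(l−1)^{2s} ≥ 2(2s+1)·l^{2s}. -/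
/-- Lower bound for a symmetric difference of powers, by Bernoulli's inequality on the side of `x`
where the derivative of the power exceeds its value at `x`. -/
theorem mul_rpow_sub_one_le_add_one_rpow_sub_sub_one_rpow {x p : ℝ} (hx : 1 ≤ x) (hp : 0 ≤ p) :
    p * x ^ (p - 1) ≤ (x + 1) ^ p - (x - 1) ^ p := by
  have hx0 : 0 < x := by linarith
  have hinv : 1 / x ≤ 1 := (div_le_one hx0).2 hx
  have hinv0 : 0 < 1 / x := by positivity
  have hsub : x ^ (p - 1) = x ^ p * (1 / x) := by
    rw [Real.rpow_sub_one hx0.ne', mul_one_div]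
  have hpos : 0 < x ^ p := Real.rpow_pos_of_pos hx0 p
  rcases le_total 1 p with h | h
  · have hb := one_add_mul_self_le_rpow_one_add (s := 1 / x) (by linarith) h
    have hfac : (x + 1) ^ p = x ^ p * (1 + 1 / x) ^ p := by
      rw [← Real.mul_rpow hx0.le (by linarith)]
      congr 1
      field_simp
    have hmono : (x - 1) ^ p ≤ x ^ p := Real.rpow_le_rpow (by linarith) (by linarith) hp
    have := mul_le_mul_of_nonneg_left hb hpos.le
    rw [hsub, hfac]
    linarith
  · have hb := rpow_one_add_le_one_add_mul_self (s := -(1 / x)) (by linarith) hp h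
    have hfac : (x - 1) ^ p = x ^ p * (1 + -(1 / x)) ^ p := by
      rw [← Real.mul_rpow hx0.le (by linarith)]
      congr 1
      field_simp
      ring
    have hmono : x ^ p ≤ (x + 1) ^ p := Real.rpow_le_rpow hx0.le (by linarith) hp
    have := mul_le_mul_of_nonneg_left hb hpos.le
    rw [hsub, hfac]
    linarith


/-- Key positivity estimate in the proof of the Carleman estimate in negative
curvature: with `α_l = (2l+d−2)(1 + 1/(l+d−2))` and `β_l = (2l+d−2)(1 − 1/l)`,
if `s ≥ 0`, or `d = 2` and `s > −1/2`, then for `l ≥ 2`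
`α_l (l+1)^{2s} − β_l (l−1)^{2s} ≥ 2(2s+1) l^{2s}`. -/
theorem denominator_lower_bound (d l : ℕ) (hd : 2 ≤ d) (hl : 2 ≤ l) (s : ℝ)
    (hs : 0 ≤ s ∨ (d = 2 ∧ -(1 / 2) < s)) :
    (2 * (l : ℝ) + d - 2) * (1 + 1 / ((l : ℝ) + d - 2)) * ((l : ℝ) + 1) ^ (2 * s)
        - (2 * (l : ℝ) + d - 2) * (1 - 1 / (l : ℝ)) * ((l : ℝ) - 1) ^ (2 * s)
      ≥ 2 * (2 * s + 1) * (l : ℝ) ^ (2 * s) := by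
  have hl2 : (2 : ℝ) ≤ l := by exact_mod_cast hl
  have hd2 : (2 : ℝ) ≤ d := by exact_mod_cast hd
  have hl0 : (0 : ℝ) < l := by linarith
  have hm : (0 : ℝ) < l + d - 2 := by linarith
  have hs' : 0 ≤ 2 * s + 1 := by rcases hs with h | ⟨-, h⟩ <;> linarith
  have key := mul_rpow_sub_one_le_add_one_rpow_sub_sub_one_rpow
    (x := (l : ℝ)) (by linarith) hs'
  rw [add_sub_cancel_right, Real.rpow_add_one (by linarith), Real.rpow_add_one (by linarith)]
    at key
  have hB : 0 ≤ ((l : ℝ) - 1) ^ (2 * s) := Real.rpow_nonneg (by linarith) _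
  have hextra : 0 ≤ ((d : ℝ) - 2) * ((1 - 1 / ((l : ℝ) + d - 2)) * ((l : ℝ) + 1) ^ (2 * s)
      - (1 - 1 / (l : ℝ)) * ((l : ℝ) - 1) ^ (2 * s)) := by
    rcases hs with h | ⟨rfl, -⟩
    · have hAB : ((l : ℝ) - 1) ^ (2 * s) ≤ ((l : ℝ) + 1) ^ (2 * s) :=
        Real.rpow_le_rpow (by linarith) (by linarith) (by linarith)
      have h1 : 1 / ((l : ℝ) + d - 2) ≤ 1 / (l : ℝ) :=
        one_div_le_one_div_of_le hl0 (by linarith)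
      have h2 : 1 / (l : ℝ) ≤ 1 := (div_le_one hl0).2 (by linarith)
      exact mul_nonneg (by linarith)
        (sub_nonneg.2 (mul_le_mul (by linarith) hAB hB (by linarith)))
    · simp
  have hα : (2 * (l : ℝ) + d - 2) * (1 + 1 / ((l : ℝ) + d - 2))
      = 2 * (l + 1) + (d - 2) * (1 - 1 / ((l : ℝ) + d - 2)) := by
    field_simp
    ring
  have hβ : (2 * (l : ℝ) + d - 2) * (1 - 1 / (l : ℝ))
      = 2 * (l - 1) + (d - 2) * (1 - 1 / (l : ℝ)) := by
    field_simp
    ring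
  rw [hα, hβ]
  linarith
end

section
/- Let d ≥ 2 and l ≥ 2 be integers, set α_l = (2l+d−2)(1 + 1/(l+d−2)) and β_l = (2l+d−2)(1 − 1/l), and let s be a real number such that either s ≥ 0, or d = 2 and s > −1/2. Then (α_l·β_l·(l²−1)^{2s}) / (α_l·(l+1)^{2s} − β_l·(l−1)^{2s}) ≤ ((d+4)²/(4(2s+1)))·l^{2s+2}. -/
/-- A Bernoulli-type inequality for negative exponents, with denominators cleared. -/
theorem one_add_div_mul_rpow_le_one {x p : ℝ} (hx : 1 < x) (hp : 0 ≤ p) :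
    (1 + p / x) * (1 - 1 / x) ^ p ≤ 1 := by
  have h0 : 0 < 1 - 1 / x := by
    rw [sub_pos, div_lt_one (by linarith)]
    exact hx
  have hpx : 0 ≤ p / x := by positivity
  have h2 : (1 - 1 / x) ^ p ≤ Real.exp (-(p / x)) := by
    rw [Real.rpow_def_of_pos h0]
    apply Real.exp_le_exp.mpr
    have h3 := Real.log_le_sub_one_of_pos h0
    calc Real.log (1 - 1 / x) * p ≤ (1 - 1 / x - 1) * p := mul_le_mul_of_nonneg_right h3 hp
      _ = -(p / x) := by ring
  calc (1 + p / x) * (1 - 1 / x) ^ p ≤ Real.exp (p / x) * Real.exp (-(p / x)) := by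
        gcongr
        linarith [Real.add_one_le_exp (p / x)]
    _ = 1 := by rw [← Real.exp_add]; simp

/-- If `z ≤ a` and `b (1 + p / x) ≤ z`, then `a b / (a - b) ≤ x z / p`. -/
theorem mul_div_sub_le {a b x z p : ℝ} (hx : 0 < x) (hp : 0 < p) (hb : 0 < b)
    (ha : z ≤ a) (hbz : b * (1 + p / x) ≤ z) : a * b / (a - b) ≤ x * z / p := by
  have hpb : 0 < b * (p / x) := by positivity
  have hab : 0 < a - b := by linarith
  have h1 : b * p ≤ (z - b) * x := by
    have h2 : b * (p / x) ≤ z - b := by linarith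
    calc b * p = b * (p / x) * x := by field_simp
      _ ≤ (z - b) * x := by gcongr
  rw [div_le_div_iff₀ hab hp]
  have h3 : a * (b * p) ≤ a * ((z - b) * x) := mul_le_mul_of_nonneg_left h1 (by linarith)
  have h4 : 0 ≤ x * b * (a - z) := by
    have : 0 ≤ a - z := by linarith
    positivity
  linarith


/-- Bound on the weight on the right-hand side of the Carleman estimate in
negative curvature for `γ_l = l^s`: with `α_l = (2l+d−2)(1 + 1/(l+d−2))` and
`β_l = (2l+d−2)(1 − 1/l)`, if `s ≥ 0`, or `d = 2` and `s > −1/2`, then for `l ≥ 2`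
`α_l β_l (l²−1)^{2s} / (α_l (l+1)^{2s} − β_l (l−1)^{2s}) ≤ ((d+4)²/(4(2s+1))) l^{2s+2}`. -/
theorem right_weight_estimate (d l : ℕ) (hd : 2 ≤ d) (hl : 2 ≤ l) (s : ℝ)
    (hs : 0 ≤ s ∨ (d = 2 ∧ -(1 / 2) < s)) :
    (2 * (l : ℝ) + d - 2) * (1 + 1 / ((l : ℝ) + d - 2))
        * ((2 * (l : ℝ) + d - 2) * (1 - 1 / (l : ℝ)))
        * (((l : ℝ) ^ 2 - 1) ^ (2 * s))
      / ((2 * (l : ℝ) + d - 2) * (1 + 1 / ((l : ℝ) + d - 2)) * ((l : ℝ) + 1) ^ (2 * s)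
          - (2 * (l : ℝ) + d - 2) * (1 - 1 / (l : ℝ)) * ((l : ℝ) - 1) ^ (2 * s))
      ≤ ((d : ℝ) + 4) ^ 2 / (4 * (2 * s + 1)) * (l : ℝ) ^ (2 * s + 2) := by
  have hx : (2 : ℝ) ≤ l := by exact_mod_cast hl
  have hd' : (2 : ℝ) ≤ d := by exact_mod_cast hd
  have hp : 0 < 2 * s + 1 := by
    rcases hs with h | ⟨-, h⟩ <;> linarith
  generalize (l : ℝ) = x at *
  have hx0 : 0 < x := by linarith
  have hk : 0 < x + d - 2 := by linarith
  have hm : 0 < 2 * x + d - 2 := by linarith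
  have hB : 0 < 1 - 1 / x := by
    rw [sub_pos, div_lt_one hx0]
    linarith
  have ha : x ^ (2 * s) ≤ (1 + 1 / (x + d - 2)) * (x + 1) ^ (2 * s) := by
    rcases hs with h | ⟨rfl, h⟩
    · have h1 : x ^ (2 * s) ≤ (x + 1) ^ (2 * s) :=
        Real.rpow_le_rpow hx0.le (by linarith) (by linarith)
      have h2 : 1 ≤ 1 + 1 / (x + d - 2) := by
        have : 0 < 1 / (x + d - 2) := by positivity
        linarith
      exact h1.trans (le_mul_of_one_le_left (by positivity) h2)
    · have h1 : x ^ (2 * s + 1) ≤ (x + 1) ^ (2 * s + 1) :=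
        Real.rpow_le_rpow hx0.le (by linarith) hp.le
      rw [Real.rpow_add_one hx0.ne', Real.rpow_add_one (by positivity)] at h1
      have h2 : 1 + 1 / (x + (2 : ℕ) - 2) = (x + 1) / x := by
        push_cast
        rw [add_sub_cancel_right]
        field_simp
      rw [h2, div_mul_eq_mul_div, le_div_iff₀ hx0]
      linarith
  have hb : (1 - 1 / x) * (x - 1) ^ (2 * s) * (1 + (2 * s + 1) / x) ≤ x ^ (2 * s) := by
    have h1 := one_add_div_mul_rpow_le_one (x := x) (by linarith) hp.le
    have h2 : (x - 1) ^ (2 * s) = x ^ (2 * s) * (1 - 1 / x) ^ (2 * s) := by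
      rw [← Real.mul_rpow hx0.le hB.le]
      congr 1
      field_simp
    rw [Real.rpow_add_one hB.ne'] at h1
    calc (1 - 1 / x) * (x - 1) ^ (2 * s) * (1 + (2 * s + 1) / x)
        = x ^ (2 * s) * ((1 + (2 * s + 1) / x) * ((1 - 1 / x) ^ (2 * s) * (1 - 1 / x))) := by
          rw [h2]; ring
      _ ≤ x ^ (2 * s) := mul_le_of_le_one_right (by positivity) h1
  have hb0 : 0 < (1 - 1 / x) * (x - 1) ^ (2 * s) :=
    mul_pos hB (Real.rpow_pos_of_pos (by linarith) _)
  have key := mul_div_sub_le hx0 hp hb0 ha hb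
  have hsq : (x ^ 2 - 1) ^ (2 * s) = (x + 1) ^ (2 * s) * (x - 1) ^ (2 * s) := by
    rw [← Real.mul_rpow (by linarith) (by linarith)]
    congr 1
    ring
  have hC : 2 * x + d - 2 ≤ ((d : ℝ) + 4) ^ 2 / 4 * x := by
    nlinarith [mul_nonneg (sub_nonneg.2 hd') (sub_nonneg.2 hx), mul_nonneg hx0.le (sq_nonneg (d : ℝ))]
  have hxs : x ^ (2 * s + 2) = x ^ (2 * s) * x ^ 2 := by
    rw [Real.rpow_add hx0, Real.rpow_two]
  rw [hsq, hxs]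
  generalize (x + 1) ^ (2 * s) = y at *
  generalize (x - 1) ^ (2 * s) = w at *
  have hz : 0 < x ^ (2 * s) := by positivity
  generalize x ^ (2 * s) = z at *
  generalize 1 + 1 / (x + d - 2) = A at *
  generalize 1 - 1 / x = B at *
  generalize 2 * x + d - 2 = m at *
  calc m * A * (m * B) * (y * w) / (m * A * y - m * B * w)
      = m * (m * (A * y * (B * w))) / (m * (A * y - B * w)) := by
        congr 1 <;> ring
    _ = m * (A * y * (B * w) / (A * y - B * w)) := by
        rw [mul_div_mul_left _ _ hm.ne', mul_div_assoc]
    _ ≤ ((d : ℝ) + 4) ^ 2 / 4 * x * (x * z / (2 * s + 1)) :=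
        (mul_le_mul_of_nonneg_left key hm.le).trans
          (mul_le_mul_of_nonneg_right hC (by positivity))
    _ = ((d : ℝ) + 4) ^ 2 / (4 * (2 * s + 1)) * (z * x ^ 2) := by
        field_simp
end

section
/- Let d ≥ 2 be an integer, set α_l = (2l+d−2)(1 + 1/(l+d−2)) and β_l = (2l+d−2)(1 − 1/l), and let s ≥ 0 be a real number. Then the sequence l ↦ (α_l·β_l·(l²−1)^{2s}) / (l^{2s+2}·(α_l·(l+1)^{2s} − β_l·(l−1)^{2s})) tends to 1/(2s+1) as l → ∞ (Tendsto along atTop to the neighborhood filter of 1/(2s+1)). -/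
open Filter

open Topology

lemma hasDerivAt_carleman_bracket (c p : ℝ) :
    HasDerivAt (fun x : ℝ => (1 + x / (1 + c * x)) * (1 + x) ^ p - (1 - x) * (1 - x) ^ p)
      (2 * (p + 1)) 0 := by
  have hx : HasDerivAt (fun x : ℝ => x) 1 0 := hasDerivAt_id 0
  have hquot := (hx.div ((hx.const_mul c).const_add 1) (by simp)).const_add 1
  have hplus := (hx.const_add 1).rpow_const (p := p) (Or.inl (by simp))
  have hminus := (hx.const_sub 1).rpow_const (p := p) (Or.inl (by simp))
  refine ((hquot.mul hplus).sub ((hx.const_sub 1).mul hminus)).congr_deriv ?_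
  simp
  ring

lemma tendsto_carleman_rescaled (c p : ℝ) (hp : 0 ≤ p) :
    Tendsto (fun x : ℝ => (2 + c * x) * (1 + x / (1 + c * x)) * (1 - x) * (1 - x ^ 2) ^ p
      / (x⁻¹ * ((1 + x / (1 + c * x)) * (1 + x) ^ p - (1 - x) * (1 - x) ^ p)))
      (𝓝[≠] 0) (𝓝 (1 / (p + 1))) := by
  have hden := hasDerivAt_iff_tendsto_slope_zero.mp (hasDerivAt_carleman_bracket c p)
  simp only [zero_add, smul_eq_mul, zero_div, mul_zero, add_zero, sub_zero, sub_self] at hden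
  have hnum : ContinuousAt (fun x : ℝ =>
      (2 + c * x) * (1 + x / (1 + c * x)) * (1 - x) * (1 - x ^ 2) ^ p) 0 := by
    have hquot : ContinuousAt (fun x : ℝ => x / (1 + c * x)) 0 :=
      ContinuousAt.div (by fun_prop) (by fun_prop) (by simp)
    have hpow : ContinuousAt (fun x : ℝ => (1 - x ^ 2) ^ p) 0 :=
      ContinuousAt.rpow_const (by fun_prop) (Or.inl (by simp))
    fun_prop
  have hlim := (hnum.tendsto.mono_left nhdsWithin_le_nhds).div hden (by positivity)
  have hvalue : (2 + c * 0) * (1 + 0 / (1 + c * 0)) * (1 - 0) * (1 - 0 ^ 2) ^ p / (2 * (p + 1))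
      = 1 / (p + 1) := by
    simp
    field_simp
  exact hvalue ▸ hlim

/-- The sequence `l ↦ α_l β_l (l²−1)^{2s} / (l^{2s+2}(α_l (l+1)^{2s} − β_l (l−1)^{2s}))`
tends to `1/(2s+1)` as `l → ∞`, where `α_l = (2l+d−2)(1 + 1/(l+d−2))` and
`β_l = (2l+d−2)(1 − 1/l)`. -/
theorem carleman_constant_limit (d : ℕ) (hd : 2 ≤ d) (s : ℝ) (hs : 0 ≤ s) :
    Tendsto (fun l : ℕ =>
      (2 * (l : ℝ) + d - 2) * (1 + 1 / ((l : ℝ) + d - 2))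
          * ((2 * (l : ℝ) + d - 2) * (1 - 1 / (l : ℝ)))
          * (((l : ℝ) ^ 2 - 1) ^ (2 * s))
        / ((l : ℝ) ^ (2 * s + 2) *
            ((2 * (l : ℝ) + d - 2) * (1 + 1 / ((l : ℝ) + d - 2)) * ((l : ℝ) + 1) ^ (2 * s)
              - (2 * (l : ℝ) + d - 2) * (1 - 1 / (l : ℝ)) * ((l : ℝ) - 1) ^ (2 * s))))
      atTop (nhds (1 / (2 * s + 1))) := by
  have hinv : Tendsto (fun l : ℕ => (l : ℝ)⁻¹) atTop (𝓝[≠] 0) :=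
    tendsto_nhdsWithin_iff.mpr ⟨tendsto_inv_atTop_nhds_zero_nat, by
      filter_upwards [eventually_gt_atTop 0] with l hl
      simpa using hl.ne'⟩
  refine ((tendsto_carleman_rescaled ((d : ℝ) - 2) (2 * s) (by positivity)).comp hinv).congr' ?_
  filter_upwards [eventually_gt_atTop 1] with l hl
  have hl1 : (1 : ℝ) < l := by exact_mod_cast hl
  have hd2 : (2 : ℝ) ≤ d := by exact_mod_cast hd
  simp only [Function.comp_apply]
  generalize (l : ℝ) = y at hl1
  obtain ⟨c, hc⟩ : ∃ c : ℝ, c = d - 2 := ⟨_, rfl⟩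
  have hc0 : 0 ≤ c := by linarith
  have hy : 0 < y := by linarith
  have hyc : y + c ≠ 0 := by positivity
  have hyc2 : 2 * y + c ≠ 0 := by positivity
  rw [add_sub_assoc, add_sub_assoc, ← hc]
  have hx1 : y⁻¹ < 1 := inv_lt_one_of_one_lt₀ hl1
  have hx0 : 0 < y⁻¹ := by positivity
  have hsq : (y ^ 2 - 1) ^ (2 * s) = y ^ (2 * s) * y ^ (2 * s) * (1 - y⁻¹ ^ 2) ^ (2 * s) := by
    rw [← Real.mul_rpow hy.le hy.le, ← Real.mul_rpow (by positivity) (by nlinarith)]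
    congr 1
    field_simp
  have hplus : (y + 1) ^ (2 * s) = y ^ (2 * s) * (1 + y⁻¹) ^ (2 * s) := by
    rw [← Real.mul_rpow hy.le (by positivity)]
    congr 1
    field_simp
  have hminus : (y - 1) ^ (2 * s) = y ^ (2 * s) * (1 - y⁻¹) ^ (2 * s) := by
    rw [← Real.mul_rpow hy.le (by linarith)]
    congr 1
    field_simp
  have hshift : y ^ (2 * s + 2) = y ^ (2 * s) * y ^ 2 := by
    rw [Real.rpow_add hy, Real.rpow_two]
  have hquot : y⁻¹ / (1 + c * y⁻¹) = 1 / (y + c) := by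
    field_simp
  have hlead : 2 + c * y⁻¹ = (2 * y + c) / y := by
    field_simp
  rw [hsq, hplus, hminus, hshift, hquot, hlead, one_div y]
  have hP : y ^ (2 * s) ≠ 0 := (Real.rpow_pos_of_pos hy _).ne'
  generalize y ^ (2 * s) = P at hP
  generalize (1 + y⁻¹) ^ (2 * s) = A
  generalize (1 - y⁻¹) ^ (2 * s) = B
  generalize (1 - y⁻¹ ^ 2) ^ (2 * s) = C
  generalize 1 + 1 / (y + c) = a
  generalize 1 - y⁻¹ = b
  have hfactor : P * y ^ 2 * ((2 * y + c) * a * (P * A) - (2 * y + c) * b * (P * B))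
      = P ^ 2 * y ^ 2 * (2 * y + c) * (a * A - b * B) := by
    ring
  rw [hfactor]
  generalize a * A - b * B = D
  field_simp
end

section
/- Let d ≥ 2 and m ≥ 1 be integers, set α_l = (2l+d−2)(1 + 1/(l+d−2)) and β_l = (2l+d−2)(1 − 1/l), let s ≥ 0 be a real number, and define C_{d,s,m} as the supremum over integers l ≥ m+1 of (α_l·β_l·(l²−1)^{2s}) / (l^{2s+2}·(α_l·(l+1)^{2s} − β_l·(l−1)^{2s})). Then 1/(2s+1) ≤ C_{d,s,m} ≤ (d+4)²/(2s+1); in particular the set of these values is nonempty and bounded above. -/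
open Filter Topology

/-- The difference `(1 - x)^{-(p+1)} - (1 + x)^{-p} (1 + (d-2)x) / (1 + (d-1)x)`, which at
`x = 1/l` governs the size of the Carleman quotient. -/
noncomputable def carlemanGap (d p x : ℝ) : ℝ :=
  (1 - x) ^ (-(p + 1)) - (1 + x) ^ (-p) * ((1 + (d - 2) * x) / (1 + (d - 1) * x))

theorem carlemanGap_zero (d p : ℝ) : carlemanGap d p 0 = 0 := by
  simp [carlemanGap]

theorem hasDerivAt_carlemanGap_zero (d p : ℝ) :
    HasDerivAt (carlemanGap d p) (2 * p + 2) 0 := by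
  have h1 : HasDerivAt (fun x : ℝ => 1 - x) (-1) 0 := (hasDerivAt_id 0).const_sub 1
  have h2 : HasDerivAt (fun x : ℝ => 1 + x) 1 0 := (hasDerivAt_id 0).const_add 1
  have h3 (c : ℝ) : HasDerivAt (fun x : ℝ => 1 + c * x) c 0 := by
    simpa using ((hasDerivAt_id (0 : ℝ)).const_mul c).const_add 1
  have h := (h1.rpow_const (p := -(p + 1)) (by simp)).sub
    ((h2.rpow_const (p := -p) (by simp)).mul ((h3 (d - 2)).div (h3 (d - 1)) (by simp)))
  refine h.congr_deriv ?_
  simp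
  ring

theorem tendsto_natCast_mul_carlemanGap (d p : ℝ) :
    Tendsto (fun l : ℕ => (l : ℝ) * carlemanGap d p (1 / (l : ℝ))) atTop (𝓝 (2 * p + 2)) := by
  have h0 : Tendsto (fun l : ℕ => 1 / (l : ℝ)) atTop (𝓝[≠] 0) := by
    refine tendsto_nhdsWithin_iff.2 ⟨tendsto_one_div_atTop_nhds_zero_nat, ?_⟩
    filter_upwards [eventually_gt_atTop 0] with l hl
    have : (0 : ℝ) < l := by exact_mod_cast hl
    exact (one_div_pos.2 this).ne'
  have h := (hasDerivAt_iff_tendsto_slope.1 (hasDerivAt_carlemanGap_zero d p)).comp h0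
  refine h.congr fun l => ?_
  simp [slope_def_field, carlemanGap_zero, div_eq_mul_inv, mul_comm]

theorem le_mul_carlemanGap {d p l : ℝ} (hd : 2 ≤ d) (hp : 0 ≤ p) (hl : 1 < l) :
    p + 1 ≤ l * carlemanGap d p (1 / l) := by
  have hl0 : 0 < l := by linarith
  have hl1 : 0 < l - 1 := by linarith
  have h1 : 1 + (p + 1) / l ≤ (1 - 1 / l) ^ (-(p + 1)) := by
    have hb : (1 - 1 / l)⁻¹ = 1 + 1 / (l - 1) := by
      have : 1 - 1 / l = (l - 1) / l := by field_simp
      rw [this, inv_div]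
      field_simp
      ring
    have hpos : 0 ≤ 1 - 1 / l := by
      rw [sub_nonneg, div_le_one hl0]
      exact hl.le
    rw [Real.rpow_neg hpos, ← Real.inv_rpow hpos, hb]
    have hx : 0 < 1 / (l - 1) := by positivity
    refine le_trans ?_ (one_add_mul_self_le_rpow_one_add (by linarith) (by linarith))
    rw [mul_one_div]
    gcongr
    linarith
  have h2 : (1 + 1 / l) ^ (-p) * ((1 + (d - 2) * (1 / l)) / (1 + (d - 1) * (1 / l))) ≤ 1 := by
    have hx : 0 < 1 / l := by positivity
    have hA : 0 ≤ (d - 2) * (1 / l) := mul_nonneg (by linarith) hx.le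
    have hB : (d - 2) * (1 / l) ≤ (d - 1) * (1 / l) := by gcongr; norm_num
    refine mul_le_one₀ (Real.rpow_le_one_of_one_le_of_nonpos (by linarith) (by linarith)) ?_ ?_
    · exact div_nonneg (by linarith) (by linarith)
    · exact (div_le_one (by linarith)).2 (by linarith)
  have h3 : (p + 1) / l ≤ carlemanGap d p (1 / l) := by
    unfold carlemanGap
    linarith
  rwa [div_le_iff₀' hl0] at h3

theorem carleman_quotient_eq {d p l : ℝ} (hd : 2 ≤ d) (hl : 1 < l) :
    (2 * l + d - 2) * (1 + 1 / (l + d - 2)) * ((2 * l + d - 2) * (1 - 1 / l))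
          * ((l ^ 2 - 1) ^ p)
        / (l ^ (p + 2) *
            ((2 * l + d - 2) * (1 + 1 / (l + d - 2)) * (l + 1) ^ p
              - (2 * l + d - 2) * (1 - 1 / l) * (l - 1) ^ p))
      = (2 + (d - 2) / l) / (l * carlemanGap d p (1 / l)) := by
  have hl0 : 0 < l := by linarith
  have hl1 : 0 < l - 1 := by linarith
  have hl2 : 0 < l + 1 := by linarith
  have hn : 0 < l + d - 2 := by linarith
  have hn1 : 0 < l + d - 1 := by linarith
  have hN : 0 < 2 * l + d - 2 := by linarith
  have e1 : (l ^ 2 - 1) ^ p = (l + 1) ^ p * (l - 1) ^ p := by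
    rw [← Real.mul_rpow hl2.le hl1.le]
    congr 1
    ring
  have e2 : l ^ (p + 2) = l ^ p * l ^ 2 := by
    rw [Real.rpow_add hl0, Real.rpow_two]
  have e3 : (1 - 1 / l) ^ (-(p + 1)) = l ^ p * l / ((l - 1) ^ p * (l - 1)) := by
    have : 1 - 1 / l = (l - 1) / l := by field_simp
    rw [this, Real.rpow_neg (by positivity), Real.div_rpow hl1.le hl0.le, inv_div,
      Real.rpow_add_one hl0.ne', Real.rpow_add_one hl1.ne']
  have e4 : (1 + 1 / l) ^ (-p) = l ^ p / (l + 1) ^ p := by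
    have : 1 + 1 / l = (l + 1) / l := by field_simp
    rw [this, Real.rpow_neg (by positivity), Real.div_rpow hl2.le hl0.le, inv_div]
  have e5 : (1 + (d - 2) * (1 / l)) / (1 + (d - 1) * (1 / l)) = (l + d - 2) / (l + d - 1) := by
    have a1 : 1 + (d - 2) * (1 / l) = (l + d - 2) / l := by field_simp; ring
    have a2 : 1 + (d - 1) * (1 / l) = (l + d - 1) / l := by field_simp; ring
    rw [a1, a2, div_div_div_cancel_right₀ hl0.ne']
  have e6 : 1 + 1 / (l + d - 2) = (l + d - 1) / (l + d - 2) := by field_simp; ring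
  have e7 : 1 - 1 / l = (l - 1) / l := by field_simp
  have e8 : 2 + (d - 2) / l = (2 * l + d - 2) / l := by field_simp; ring
  unfold carlemanGap
  rw [e1, e2, e3, e4, e5, e6, e7, e8]
  have hu : 0 < (l + 1) ^ p := Real.rpow_pos_of_pos hl2 p
  have hv : 0 < (l - 1) ^ p := Real.rpow_pos_of_pos hl1 p
  generalize (l + 1) ^ p = u at *
  generalize (l - 1) ^ p = v at *
  generalize l ^ p = w at *
  generalize l + d - 2 = n at *
  generalize l + d - 1 = n' at *
  generalize 2 * l + d - 2 = N at *
  generalize l - 1 = k at *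
  have hc : N * (n' / n) * (k / l) * l * u * v ≠ 0 := by positivity
  rw [← mul_div_mul_left (N / l) _ hc]
  congr 1 <;> field_simp


/-- Two-sided bounds on the best constant `C_{d,s,m}`, defined as the supremum over
`l ≥ m+1` of `α_l β_l (l²−1)^{2s} / (l^{2s+2}(α_l (l+1)^{2s} − β_l (l−1)^{2s}))`:
the set of values is nonempty and bounded above, and
`1/(2s+1) ≤ C_{d,s,m} ≤ (d+4)²/(2s+1)`. -/
theorem carleman_constant_bounds (d m : ℕ) (hd : 2 ≤ d) (hm : 1 ≤ m) (s : ℝ) (hs : 0 ≤ s) :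
    let E : ℕ → ℝ := fun l =>
      (2 * (l : ℝ) + d - 2) * (1 + 1 / ((l : ℝ) + d - 2))
          * ((2 * (l : ℝ) + d - 2) * (1 - 1 / (l : ℝ)))
          * (((l : ℝ) ^ 2 - 1) ^ (2 * s))
        / ((l : ℝ) ^ (2 * s + 2) *
            ((2 * (l : ℝ) + d - 2) * (1 + 1 / ((l : ℝ) + d - 2)) * ((l : ℝ) + 1) ^ (2 * s)
              - (2 * (l : ℝ) + d - 2) * (1 - 1 / (l : ℝ)) * ((l : ℝ) - 1) ^ (2 * s)))
    let S : Set ℝ := {x | ∃ l : ℕ, m + 1 ≤ l ∧ x = E l}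
    S.Nonempty ∧ BddAbove S ∧
      1 / (2 * s + 1) ≤ sSup S ∧ sSup S ≤ ((d : ℝ) + 4) ^ 2 / (2 * s + 1) := by
  intro E S
  have hd' : (2 : ℝ) ≤ d := by exact_mod_cast hd
  have hE (l : ℕ) (hl : m + 1 ≤ l) :
      E l = (2 + ((d : ℝ) - 2) / l) / (l * carlemanGap d (2 * s) (1 / l)) :=
    carleman_quotient_eq hd' (by exact_mod_cast (by omega : 1 < l))
  have hub : ∀ x ∈ S, x ≤ ((d : ℝ) + 4) ^ 2 / (2 * s + 1) := by
    rintro x ⟨l, hl, rfl⟩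
    have hl1 : (1 : ℝ) < l := by exact_mod_cast (by omega : 1 < l)
    rw [hE l hl]
    refine div_le_div₀ (by positivity) ?_ (by linarith)
      (le_mul_carlemanGap hd' (by linarith) hl1)
    have : ((d : ℝ) - 2) / l ≤ d - 2 := div_le_self (by linarith) hl1.le
    nlinarith
  have hne : S.Nonempty := ⟨E (m + 1), m + 1, le_rfl, rfl⟩
  have hbdd : BddAbove S := ⟨_, hub⟩
  refine ⟨hne, hbdd, ?_, csSup_le hne hub⟩
  have hlim : Tendsto E atTop (𝓝 (1 / (2 * s + 1))) := by
    have hnum : Tendsto (fun l : ℕ => 2 + ((d : ℝ) - 2) / l) atTop (𝓝 (2 + 0)) :=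
      (tendsto_const_div_atTop_nhds_zero_nat ((d : ℝ) - 2)).const_add 2
    have h := hnum.div (tendsto_natCast_mul_carlemanGap d (2 * s)) (by positivity)
    have hval : (2 + 0) / (2 * (2 * s) + 2) = 1 / (2 * s + 1) := by
      have : 2 * s + 1 ≠ 0 := by positivity
      field_simp
      ring
    rw [hval] at h
    refine h.congr' ?_
    filter_upwards [eventually_ge_atTop (m + 1)] with l hl
    exact (hE l hl).symm
  refine le_of_tendsto hlim ?_
  filter_upwards [eventually_ge_atTop (m + 1)] with l hl
  exact le_csSup hbdd ⟨l, hl, rfl⟩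
end

section
/- Let m ≥ 1 be an integer, let S > 0 be a real number, and let (r_l)_{l ≥ m} be a sequence of positive real numbers satisfying 2S·r_{l−2} ≤ l·(r_l − r_{l−2}) for every integer l ≥ m+2. Then for every integer k ≥ 1, r_{m+2k} ≥ (∏_{j=1}^{k} (m+2j+2S)/(m+2j))·r_m. Moreover, if S is a positive integer, then for every integer k ≥ 1, r_{m+2k} ≥ ((m+2k)^S/(m+2S)^S)·r_m. -/
/-- Shifting the numerators of `∏ i < n, (a + 2k + 2i + 2) / (a + 2i + 2)` by one step. -/
theorem prod_shift_ratio_succ {a : ℝ} (ha : 0 < a) (k n : ℕ) :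
    ∏ i ∈ Finset.range n, ((a + 2 * (k + 1 : ℕ) + 2 * i + 2) / (a + 2 * i + 2)) =
      (∏ i ∈ Finset.range n, ((a + 2 * k + 2 * i + 2) / (a + 2 * i + 2))) *
        ((a + 2 * (k + 1 : ℕ) + 2 * n) / (a + 2 * (k + 1 : ℕ))) := by
  induction n with
  | zero =>
    have : a + 2 * ((k + 1 : ℕ) : ℝ) ≠ 0 := by positivity
    simp only [Finset.prod_range_zero, Nat.cast_zero, mul_zero, add_zero, div_self this, mul_one]
  | succ n ih =>
    rw [Finset.prod_range_succ, Finset.prod_range_succ, ih]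
    have h1 : a + 2 * ((k + 1 : ℕ) : ℝ) ≠ 0 := by positivity
    have h2 : a + 2 * (n : ℝ) + 2 ≠ 0 := by positivity
    generalize ∏ i ∈ Finset.range n, ((a + 2 * (k : ℝ) + 2 * i + 2) / (a + 2 * i + 2)) = P
    field_simp
    push_cast
    ring

/-- The telescoping product of shifted ratios is symmetric in its length and its shift. -/
theorem prod_shift_ratio_comm {a : ℝ} (ha : 0 < a) (k n : ℕ) :
    ∏ j ∈ Finset.Icc 1 k, ((a + 2 * j + 2 * n) / (a + 2 * j)) =
      ∏ i ∈ Finset.range n, ((a + 2 * k + 2 * i + 2) / (a + 2 * i + 2)) := by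
  induction k with
  | zero =>
    rw [Finset.prod_eq_one (s := Finset.range n)]
    · simp
    · intro i _
      have : a + 2 * (i : ℝ) + 2 ≠ 0 := by positivity
      simp [div_self this]
  | succ k ih =>
    rw [Finset.prod_Icc_succ_top (by omega), ih, prod_shift_ratio_succ ha]

/-- Polynomial lower bound, of degree `n`, for the product of shifted ratios. -/
theorem pow_div_pow_le_prod_shift_ratio {a : ℝ} (ha : 0 < a) (k n : ℕ) :
    (a + 2 * k) ^ n / (a + 2 * n) ^ n ≤
      ∏ j ∈ Finset.Icc 1 k, ((a + 2 * j + 2 * n) / (a + 2 * j)) := by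
  rw [prod_shift_ratio_comm ha, ← div_pow]
  calc ((a + 2 * k) / (a + 2 * n)) ^ n
      = ∏ _i ∈ Finset.range n, ((a + 2 * k) / (a + 2 * n)) := by
        rw [Finset.prod_const, Finset.card_range]
    _ ≤ _ := by
      refine Finset.prod_le_prod (fun i _ => by positivity) fun i hi => ?_
      have hin : (i : ℝ) + 1 ≤ n := by exact_mod_cast Finset.mem_range.mp hi
      have hi0 : (0 : ℝ) ≤ i := i.cast_nonneg
      exact div_le_div₀ (by positivity) (by linarith) (by positivity) (by linarith)

/-- The inductive weight-growth lemma: if positive weights `(r_l)_{l ≥ m}` satisfy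
`2S r_{l−2} ≤ l(r_l − r_{l−2})` for `l ≥ m+2`, then
`r_{m+2k} ≥ (∏_{j=1}^k (m+2j+2S)/(m+2j)) r_m` for every `k ≥ 1`; moreover if `S`
is a positive integer then `r_{m+2k} ≥ ((m+2k)^S/(m+2S)^S) r_m` for every `k ≥ 1`. -/
theorem weight_growth_lemma (m : ℕ) (hm : 1 ≤ m) (S : ℝ) (hS : 0 < S) (r : ℕ → ℝ)
    (hrpos : ∀ l : ℕ, m ≤ l → 0 < r l)
    (hgrow : ∀ l : ℕ, m + 2 ≤ l → 2 * S * r (l - 2) ≤ (l : ℝ) * (r l - r (l - 2))) :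
    (∀ k : ℕ, 1 ≤ k →
      (∏ j ∈ Finset.Icc 1 k, (((m : ℝ) + 2 * j + 2 * S) / ((m : ℝ) + 2 * j))) * r m
        ≤ r (m + 2 * k)) ∧
    ((∃ n : ℕ, S = n) → ∀ k : ℕ, 1 ≤ k →
      ((m : ℝ) + 2 * k) ^ S / ((m : ℝ) + 2 * S) ^ S * r m ≤ r (m + 2 * k)) := by
  have hm0 : (0 : ℝ) < m := by exact_mod_cast hm
  have key : ∀ k : ℕ,
      (∏ j ∈ Finset.Icc 1 k, (((m : ℝ) + 2 * j + 2 * S) / ((m : ℝ) + 2 * j))) * r m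
        ≤ r (m + 2 * k) := by
    intro k
    induction k with
    | zero => simp
    | succ k ih =>
      have h := hgrow (m + 2 * (k + 1)) (by omega)
      rw [show m + 2 * (k + 1) - 2 = m + 2 * k by omega] at h
      have hp : (0 : ℝ) < m + 2 * (k + 1 : ℕ) := by positivity
      have hstep : ((m : ℝ) + 2 * (k + 1 : ℕ) + 2 * S) / (m + 2 * (k + 1 : ℕ)) * r (m + 2 * k)
          ≤ r (m + 2 * (k + 1)) := by
        rw [div_mul_eq_mul_div, div_le_iff₀ hp]
        push_cast at h ⊢
        linarith
      rw [Finset.prod_Icc_succ_top (by omega), mul_right_comm, mul_comm]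
      exact (mul_le_mul_of_nonneg_left ih (by positivity)).trans hstep
  refine ⟨fun k _ => key k, ?_⟩
  rintro ⟨n, rfl⟩ k _
  rw [Real.rpow_natCast, Real.rpow_natCast]
  exact (mul_le_mul_of_nonneg_right (pow_div_pow_le_prod_shift_ratio hm0 k n)
    (hrpos m le_rfl).le).trans (key k)
end

section
/- Let d ≥ 2 and m ≥ 1 be integers and κ > 0 a real number. Set λ_l = l(l+d−2) for l ≥ 0; set α_0 = d−1 and α_l = (2l+d−2)(1 + 1/(l+d−2)) for l ≥ 1; set β_l = (2l+d−2)(1 − 1/l) for l ≥ 2. Let (a_l)_{l≥m}, (b_l)_{l≥m}, (z_l)_{l≥m}, (p_l)_{l≥m} and (f_l)_{l≥m+1} be sequences of nonnegative real numbers such that a_l = 0 for all sufficiently large l, and such that for every integer l ≥ m: (i) α_{l−1}·a_l + κ·λ_l·b_l + z_l ≤ β_{l+1}·p_l; and (ii) √(p_l) ≤ √(f_{l+1}) + √(a_{l+2}). Let (γ_l)_{l≥m} be positive reals satisfying α_l·γ_{l+1}² > β_l·γ_{l−1}² for all l ≥ m+1, and let (δ_l)_{l≥m+1} be reals with 0 <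 δ_l ≤ 1. Then, with sums taken in [0,+∞]: Σ_{l=m}^{m+1} α_{l−1}γ_l²·a_l + Σ_{l=m+2}^{∞} (1−δ_{l−1})(α_{l−1}γ_l² − β_{l−1}γ_{l−2}²)·a_l + κ·Σ_{l=m}^{∞} λ_l γ_l²·b_l + Σ_{l=m}^{∞} γ_l²·z_l ≤ Σ_{l=m+1}^{∞} [1 + ((1−δ_l)/δ_l)·(β_l γ_{l−1}²/(α_l γ_{l+1}²))]·(α_l γ_{l+1}²·β_l γ_{l−1}²/(α_l γ_{l+1}² − β_l γ_{l−1}²))·f_l. -/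
open scoped ENNReal in
/-- Summing a two-step recursive inequality whose telescoping part has finite total mass. -/
theorem ENNReal.two_step_telescope {w g c : ℕ → ℝ≥0∞} (hw : ∑' k, w k ≠ ∞)
    (h : ∀ k, w k + g k ≤ c k + w (k + 2)) :
    w 0 + w 1 + ∑' k, g k ≤ ∑' k, c k := by
  have hsplit : ∑' k, w k = w 0 + w 1 + ∑' k, w (k + 2) := by
    rw [← ENNReal.summable.sum_add_tsum_nat_add' (k := 2), Finset.sum_range_succ,
      Finset.sum_range_one]
  have htail : ∑' k, w (k + 2) ≠ ∞ := fun htop => hw (by rw [hsplit, htop, add_top])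
  have hsum := ENNReal.tsum_le_tsum h
  rw [ENNReal.tsum_add, ENNReal.tsum_add, hsplit] at hsum
  refine (ENNReal.add_le_add_iff_right htail).1 (le_trans (le_of_eq ?_) hsum)
  ring

/-- Cauchy's inequality with parameter `δ * (A / B - 1)`, in the form that absorbs the `a` term. -/
theorem mul_le_of_sqrt_le_sqrt_add_sqrt {A B δ p f a : ℝ} (hB : 0 < B) (hAB : B < A)
    (hδ : 0 < δ) (hp : 0 ≤ p) (hf : 0 ≤ f) (ha : 0 ≤ a)
    (h : √p ≤ √f + √a) :
    B * p + (1 - δ) * (A - B) * a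
      ≤ (1 + (1 - δ) / δ * (B / A)) * (A * B / (A - B)) * f + A * a := by
  have hA : 0 < A := hB.trans hAB
  have hD : 0 < A - B := sub_pos.2 hAB
  have hpfa : p ≤ (√f + √a) ^ 2 := by
    rw [← Real.sq_sqrt hp]
    gcongr
  have hcoef : (1 + (1 - δ) / δ * (B / A)) * (A * B / (A - B)) = B + B ^ 2 / (δ * (A - B)) := by
    field_simp
    ring
  have hsq : B ^ 2 / (δ * (A - B)) * f + δ * (A - B) * a - 2 * B * √f * √a
      = (B * √f - δ * (A - B) * √a) ^ 2 / (δ * (A - B)) := by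
    conv_lhs => rw [← Real.sq_sqrt hf, ← Real.sq_sqrt ha, Real.sqrt_sq (Real.sqrt_nonneg f),
      Real.sqrt_sq (Real.sqrt_nonneg a)]
    field_simp
    ring
  have hnonneg : 0 ≤ (B * √f - δ * (A - B) * √a) ^ 2 / (δ * (A - B)) := by positivity
  have hBp := mul_le_mul_of_nonneg_left hpfa hB.le
  rw [add_sq, Real.sq_sqrt hf, Real.sq_sqrt ha] at hBp
  rw [hcoef]
  linarith


/-- Real-sequence content of the Carleman estimate with general weights in negative
curvature (Proposition 5.2): here `a_l = ‖X₋u_l‖²`, `b_l = ‖u_l‖²`, `z_l = ‖Z(u_l)‖²`,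
`p_l = ‖X₊u_l‖²`, `f_l = ‖(Xu)_l‖²`, hypothesis `hpestov` is the frequency-localized
Pestov inequality in curvature `≤ −κ`, and `htriangle` comes from
`X₊u_l = (Xu)_{l+1} − X₋u_{l+2}`. Sums are taken in `ℝ≥0∞` via `ENNReal.ofReal`,
with `Σ_{l=c}^∞ g l` written as `∑' k, g (c + k)`. -/
theorem carleman_general_weights (d m : ℕ) (hd : 2 ≤ d) (hm : 1 ≤ m)
    (κ : ℝ) (hκ : 0 < κ)
    (lam α β : ℕ → ℝ)
    (hlam : ∀ l : ℕ, lam l = (l : ℝ) * ((l : ℝ) + d - 2))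
    (hα0 : α 0 = (d : ℝ) - 1)
    (hα : ∀ l : ℕ, 1 ≤ l → α l = (2 * (l : ℝ) + d - 2) * (1 + 1 / ((l : ℝ) + d - 2)))
    (hβ : ∀ l : ℕ, 2 ≤ l → β l = (2 * (l : ℝ) + d - 2) * (1 - 1 / (l : ℝ)))
    (a b z p f : ℕ → ℝ)
    (ha : ∀ l : ℕ, m ≤ l → 0 ≤ a l) (hb : ∀ l : ℕ, m ≤ l → 0 ≤ b l)
    (hz : ∀ l : ℕ, m ≤ l → 0 ≤ z l) (hp : ∀ l : ℕ, m ≤ l → 0 ≤ p l)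
    (hf : ∀ l : ℕ, m + 1 ≤ l → 0 ≤ f l)
    (hafin : ∃ L : ℕ, ∀ l : ℕ, L ≤ l → a l = 0)
    (hpestov : ∀ l : ℕ, m ≤ l →
      α (l - 1) * a l + κ * lam l * b l + z l ≤ β (l + 1) * p l)
    (htriangle : ∀ l : ℕ, m ≤ l →
      Real.sqrt (p l) ≤ Real.sqrt (f (l + 1)) + Real.sqrt (a (l + 2)))
    (γ : ℕ → ℝ) (hγpos : ∀ l : ℕ, m ≤ l → 0 < γ l)
    (hγ : ∀ l : ℕ, m + 1 ≤ l → β l * γ (l - 1) ^ 2 < α l * γ (l + 1) ^ 2)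
    (δ : ℕ → ℝ) (hδ : ∀ l : ℕ, m + 1 ≤ l → 0 < δ l ∧ δ l ≤ 1) :
    ENNReal.ofReal (α (m - 1) * γ m ^ 2 * a m)
      + ENNReal.ofReal (α m * γ (m + 1) ^ 2 * a (m + 1))
      + (∑' k : ℕ, ENNReal.ofReal ((1 - δ (m + 1 + k))
          * (α (m + 1 + k) * γ (m + 2 + k) ^ 2 - β (m + 1 + k) * γ (m + k) ^ 2)
          * a (m + 2 + k)))
      + ENNReal.ofReal κ
          * (∑' k : ℕ, ENNReal.ofReal (lam (m + k) * γ (m + k) ^ 2 * b (m + k)))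
      + (∑' k : ℕ, ENNReal.ofReal (γ (m + k) ^ 2 * z (m + k)))
    ≤ ∑' k : ℕ, ENNReal.ofReal (
        (1 + (1 - δ (m + 1 + k)) / δ (m + 1 + k)
            * (β (m + 1 + k) * γ (m + k) ^ 2 / (α (m + 1 + k) * γ (m + 2 + k) ^ 2)))
        * (α (m + 1 + k) * γ (m + 2 + k) ^ 2 * (β (m + 1 + k) * γ (m + k) ^ 2)
            / (α (m + 1 + k) * γ (m + 2 + k) ^ 2 - β (m + 1 + k) * γ (m + k) ^ 2))
        * f (m + 1 + k)) := by
  have hd' : (2 : ℝ) ≤ d := by exact_mod_cast hd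
  have hαnn (l : ℕ) : 0 ≤ α l := by
    rcases Nat.eq_zero_or_pos l with rfl | hl
    · linarith
    · have hl' : (1 : ℝ) ≤ l := by exact_mod_cast hl
      rw [hα l hl]
      have h₁ : 0 < (l : ℝ) + d - 2 := by linarith
      have h₂ : 0 < 2 * (l : ℝ) + d - 2 := by linarith
      positivity
  have hβpos (l : ℕ) (hl : 2 ≤ l) : 0 < β l := by
    have hl' : (2 : ℝ) ≤ l := by exact_mod_cast hl
    rw [hβ l hl]
    have h₁ : 1 / (l : ℝ) < 1 := by rw [div_lt_one] <;> linarith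
    exact mul_pos (by linarith) (by linarith)
  have hlamnn (l : ℕ) : 0 ≤ lam l := by
    rw [hlam]
    have hl' : (0 : ℝ) ≤ l := by positivity
    exact mul_nonneg hl' (by linarith)
  set w : ℕ → ℝ := fun k => α (m + k - 1) * γ (m + k) ^ 2 * a (m + k) with hwdef
  have hwnn (k : ℕ) : 0 ≤ w k :=
    mul_nonneg (mul_nonneg (hαnn _) (sq_nonneg _)) (ha _ (by omega))
  have hwfin : ∑' k, ENNReal.ofReal (w k) ≠ ⊤ := by
    obtain ⟨L, hL⟩ := hafin
    rw [tsum_eq_sum (s := Finset.range L)]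
    · exact ENNReal.sum_ne_top.2 fun _ _ => ENNReal.ofReal_ne_top
    · intro k hk
      have hk' : L ≤ m + k := by rw [Finset.mem_range] at hk; omega
      simp [hwdef, hL _ hk']
  rw [← ENNReal.tsum_mul_left, add_assoc, add_assoc, ← ENNReal.tsum_add, ← ENNReal.tsum_add]
  rw [show α (m - 1) * γ m ^ 2 * a m = w 0 from rfl,
    show α m * γ (m + 1) ^ 2 * a (m + 1) = w 1 from rfl]
  refine ENNReal.two_step_telescope (w := fun k => ENNReal.ofReal (w k)) hwfin fun k => ?_
  obtain ⟨hδ₀, hδ₁⟩ := hδ (m + 1 + k) (by omega)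
  have hAB := hγ (m + 1 + k) (by omega)
  rw [show m + 1 + k - 1 = m + k by omega, show m + 1 + k + 1 = m + 2 + k by omega] at hAB
  have hγk := hγpos (m + k) (by omega)
  have hB : 0 < β (m + 1 + k) * γ (m + k) ^ 2 :=
    mul_pos (hβpos _ (by omega)) (by positivity)
  have hak := ha (m + 2 + k) (by omega)
  have hfk := hf (m + 1 + k) (by omega)
  have htri := htriangle (m + k) (by omega)
  have hpes := mul_le_mul_of_nonneg_left (hpestov (m + k) (by omega)) (sq_nonneg (γ (m + k)))
  rw [show m + k + 1 = m + 1 + k by omega] at htri hpes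
  rw [show m + k + 2 = m + 2 + k by omega] at htri
  have hcauchy := mul_le_of_sqrt_le_sqrt_add_sqrt hB hAB hδ₀ (hp (m + k) (by omega)) hfk hak htri
  have hw2 : w (k + 2) = α (m + 1 + k) * γ (m + 2 + k) ^ 2 * a (m + 2 + k) := by
    simp only [hwdef]
    rw [show m + (k + 2) - 1 = m + 1 + k by omega, show m + (k + 2) = m + 2 + k by omega]
  have hD := sub_pos.2 hAB
  have hA := hB.trans hAB
  have hδ₂ : 0 ≤ 1 - δ (m + 1 + k) := sub_nonneg.2 hδ₁
  have hbk : 0 ≤ lam (m + k) * γ (m + k) ^ 2 * b (m + k) :=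
    mul_nonneg (mul_nonneg (hlamnn _) (sq_nonneg _)) (hb _ (by omega))
  have hzk : 0 ≤ γ (m + k) ^ 2 * z (m + k) := mul_nonneg (sq_nonneg _) (hz _ (by omega))
  rw [← ENNReal.ofReal_mul hκ.le, ← ENNReal.ofReal_add (mul_nonneg hκ.le hbk) hzk,
    ← ENNReal.ofReal_add (by positivity) (by positivity),
    ← ENNReal.ofReal_add (hwnn k) (by positivity),
    ← ENNReal.ofReal_add (by positivity) (hwnn _), hw2]
  refine ENNReal.ofReal_le_ofReal ?_
  simp only [hwdef]
  linarith
end
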